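/- Deterministic conversion in the orthogonal case: let T1 = a1⊗b1⊗c1 and T2 = a2⊗b2⊗c2 be unit product vectors in ℂ²⊗ℂ²⊗ℂ² with ⟨T1, T2⟩ = 0, and let α, β > 0 with α² + β² = 1. Put ψ = α·T1 + β·T2. Then there exists a complete product family {O_i = A_i⊗B_i⊗C_i}_{i∈F} such that for every i ∈ F, O_i|GHZ⟩ is a complex scalar multiple of ψ; i.e., |GHZ⟩ can be transformed to ψ by LOCC with probability 1. -/

import Mathlib

noncomputable section

open scoped InnerProductSpace
open Matrix

/-- Tensor product of three vectors of `ℂ²`, realized inside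
`EuclideanSpace ℂ (Fin 2 × Fin 2 × Fin 2)` (the three-qubit Hilbert space). -/
def tp3 (a b c : EuclideanSpace ℂ (Fin 2)) : EuclideanSpace ℂ (Fin 2 × Fin 2 × Fin 2) :=
  (WithLp.equiv 2 _).symm fun p => a p.1 * b p.2.1 * c p.2.2

/-- The product operator `A ⊗ B ⊗ C` on the three-qubit Hilbert space, as a matrix. -/
def kron3 (A B C : Matrix (Fin 2) (Fin 2) ℂ) :
    Matrix (Fin 2 × Fin 2 × Fin 2) (Fin 2 × Fin 2 × Fin 2) ℂ :=
  fun p q => A p.1 q.1 * B p.2.1 q.2.1 * C p.2.2 q.2.2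

/-- The computational basis vector `|i⟩` of `ℂ²`. -/
def ket (i : Fin 2) : EuclideanSpace ℂ (Fin 2) := EuclideanSpace.single i 1

/-- The GHZ state `(|000⟩ + |111⟩)/√2`. -/
def GHZ : EuclideanSpace ℂ (Fin 2 × Fin 2 × Fin 2) :=
  (Real.sqrt 2 : ℂ)⁻¹ • (tp3 (ket 0) (ket 0) (ket 0) + tp3 (ket 1) (ket 1) (ket 1))

/-- The matrix with columns `x • u` and `y • v`. -/
def colMatrix (x y : ℂ) (u v : EuclideanSpace ℂ (Fin 2)) : Matrix (Fin 2) (Fin 2) ℂ :=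
  !![x * u 0, y * v 0; x * u 1, y * v 1]

lemma kron3_conjTranspose_mul_self (A B C : Matrix (Fin 2) (Fin 2) ℂ) :
    (kron3 A B C)ᴴ * kron3 A B C = kron3 (Aᴴ * A) (Bᴴ * B) (Cᴴ * C) := by
  ext p q
  simp only [Matrix.mul_apply, kron3, Matrix.conjTranspose_apply, Fintype.sum_prod_type,
    Fin.sum_univ_two, star_mul']
  ring

lemma colMatrix_conjTranspose_mul_self (x y : ℝ) (u v : EuclideanSpace ℂ (Fin 2)) :
    (colMatrix x y u v)ᴴ * colMatrix x y u v =
      !![x * x * ⟪u, u⟫_ℂ, x * y * ⟪u, v⟫_ℂ; x * y * ⟪v, u⟫_ℂ, y * y * ⟪v, v⟫_ℂ] := by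
  ext p q
  fin_cases p <;> fin_cases q <;>
    simp [colMatrix, Matrix.mul_apply, PiLp.inner_apply, Fin.sum_univ_two,
      -inner_self_eq_norm_sq_to_K] <;> ring

lemma inner_tp3 (a b c a' b' c' : EuclideanSpace ℂ (Fin 2)) :
    ⟪tp3 a b c, tp3 a' b' c'⟫_ℂ = ⟪a, a'⟫_ℂ * ⟪b, b'⟫_ℂ * ⟪c, c'⟫_ℂ := by
  simp only [tp3, PiLp.inner_apply, Fintype.sum_prod_type, Fin.sum_univ_two,
    WithLp.equiv_symm_apply, RCLike.inner_apply, map_mul]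
  ring

lemma norm_tp3 (a b c : EuclideanSpace ℂ (Fin 2)) : ‖tp3 a b c‖ = ‖a‖ * ‖b‖ * ‖c‖ := by
  have h := inner_tp3 a b c a b c
  simp only [inner_self_eq_norm_sq_to_K] at h
  have h' : ‖tp3 a b c‖ ^ 2 = (‖a‖ * ‖b‖ * ‖c‖) ^ 2 := by
    rw [mul_pow, mul_pow]
    exact_mod_cast h
  exact (pow_left_inj₀ (norm_nonneg _) (by positivity) two_ne_zero).mp h'

lemma tp3_smul (x y z : ℂ) (a b c : EuclideanSpace ℂ (Fin 2)) :
    tp3 (x • a) (y • b) (z • c) = (x * y * z) • tp3 a b c := by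
  ext p
  simp [tp3]
  ring

/-- A unit product vector is a product of unit vectors. -/
lemma exists_unit_factors {a b c : EuclideanSpace ℂ (Fin 2)} (h : ‖tp3 a b c‖ = 1) :
    ∃ a' b' c' : EuclideanSpace ℂ (Fin 2), tp3 a b c = tp3 a' b' c' ∧
      ‖a'‖ = 1 ∧ ‖b'‖ = 1 ∧ ‖c'‖ = 1 := by
  rw [norm_tp3] at h
  have ha : a ≠ 0 := by rintro rfl; simp at h
  have hb : b ≠ 0 := by rintro rfl; simp at h
  have hc : c ≠ 0 := by rintro rfl; simp at h
  refine ⟨(‖a‖ : ℂ)⁻¹ • a, (‖b‖ : ℂ)⁻¹ • b, (‖c‖ : ℂ)⁻¹ • c, ?_,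
    norm_smul_inv_norm ha, norm_smul_inv_norm hb, norm_smul_inv_norm hc⟩
  have h' : (‖a‖ : ℂ) * ‖b‖ * ‖c‖ = 1 := by exact_mod_cast h
  rw [tp3_smul, ← mul_inv, ← mul_inv, h', inv_one, one_smul]

lemma toEuclideanLin_kron3_GHZ (x y x' y' x'' y'' : ℂ)
    (a b c a' b' c' : EuclideanSpace ℂ (Fin 2)) :
    Matrix.toEuclideanLin
      (kron3 (colMatrix x y a a') (colMatrix x' y' b b') (colMatrix x'' y'' c c')) GHZ =
      (Real.sqrt 2 : ℂ)⁻¹ •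
        ((x * x' * x'') • tp3 a b c + (y * y' * y'') • tp3 a' b' c') := by
  ext ⟨i, j, k⟩
  fin_cases i <;> fin_cases j <;> fin_cases k <;>
    simp [Matrix.toLpLin_apply, Matrix.mulVec, dotProduct, Fintype.sum_prod_type,
      Fin.sum_univ_two, GHZ, tp3, ket, kron3, colMatrix] <;> ring

/-- The signs `±1` labelling measurement outcomes. -/
def outcomeSign (i : Fin 2) : ℝ := ![1, -1] i

/-- The first local factor of the branches of the conversion protocol. -/
def branchA (α β : ℝ) (a1 a2 : EuclideanSpace ℂ (Fin 2)) (i : Fin 2 × Fin 2 × Fin 2) :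
    Matrix (Fin 2) (Fin 2) ℂ :=
  ![colMatrix (α / 2 : ℝ) (outcomeSign i.2.1 * outcomeSign i.2.2 * β / 2 : ℝ) a1 a2,
    colMatrix (outcomeSign i.2.1 * outcomeSign i.2.2 * β / 2 : ℝ) (α / 2 : ℝ) a2 a1] i.1

/-- The local factor of the branches of the conversion protocol for either of the parties
performing a sign measurement, with flip `k` and outcome `s`. -/
def branchSign (b1 b2 : EuclideanSpace ℂ (Fin 2)) (k s : Fin 2) : Matrix (Fin 2) (Fin 2) ℂ :=
  ![colMatrix (1 : ℝ) (outcomeSign s) b1 b2, colMatrix (outcomeSign s) (1 : ℝ) b2 b1] k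

set_option maxHeartbeats 2000000 in
lemma sum_branch_eq_one {a1 b1 c1 a2 b2 c2 : EuclideanSpace ℂ (Fin 2)}
    (ha1 : ‖a1‖ = 1) (hb1 : ‖b1‖ = 1) (hc1 : ‖c1‖ = 1)
    (ha2 : ‖a2‖ = 1) (hb2 : ‖b2‖ = 1) (hc2 : ‖c2‖ = 1)
    (horth : ⟪a1, a2⟫_ℂ = 0 ∨ ⟪b1, b2⟫_ℂ = 0 ∨ ⟪c1, c2⟫_ℂ = 0)
    {α β : ℝ} (hnorm : α ^ 2 + β ^ 2 = 1) :
    ∑ i : Fin 2 × Fin 2 × Fin 2,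
      (kron3 (branchA α β a1 a2 i) (branchSign b1 b2 i.1 i.2.1) (branchSign c1 c2 i.1 i.2.2))ᴴ *
        kron3 (branchA α β a1 a2 i) (branchSign b1 b2 i.1 i.2.1) (branchSign c1 c2 i.1 i.2.2) =
      1 := by
  have hn : (α : ℂ) ^ 2 + (β : ℂ) ^ 2 = 1 := by exact_mod_cast hnorm
  have horth' : ⟪a1, a2⟫_ℂ = 0 ∧ ⟪a2, a1⟫_ℂ = 0 ∨ ⟪b1, b2⟫_ℂ = 0 ∧ ⟪b2, b1⟫_ℂ = 0 ∨
      ⟪c1, c2⟫_ℂ = 0 ∧ ⟪c2, c1⟫_ℂ = 0 := by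
    simpa only [inner_eq_zero_symm (x := a2), inner_eq_zero_symm (x := b2),
      inner_eq_zero_symm (x := c2), and_self] using horth
  simp only [kron3_conjTranspose_mul_self, Fintype.sum_prod_type, Fin.sum_univ_two, branchA,
    branchSign, Matrix.cons_val_zero, Matrix.cons_val_one, colMatrix_conjTranspose_mul_self,
    inner_self_eq_norm_sq_to_K, ha1, hb1, hc1, ha2, hb2, hc2]
  generalize ⟪a1, a2⟫_ℂ = g at *
  generalize ⟪a2, a1⟫_ℂ = g' at *
  generalize ⟪b1, b2⟫_ℂ = h at *
  generalize ⟪b2, b1⟫_ℂ = h' at *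
  generalize ⟪c1, c2⟫_ℂ = k at *
  generalize ⟪c2, c1⟫_ℂ = k' at *
  ext ⟨p1, p2, p3⟩ ⟨q1, q2, q3⟩
  fin_cases p1 <;> fin_cases p2 <;> fin_cases p3 <;>
    fin_cases q1 <;> fin_cases q2 <;> fin_cases q3 <;>
    simp [kron3, outcomeSign] <;>
    first | ring1 | linear_combination hn |
      (rcases horth' with ⟨rfl, rfl⟩ | ⟨rfl, rfl⟩ | ⟨rfl, rfl⟩ <;> simp)

lemma branch_apply_GHZ (a1 b1 c1 a2 b2 c2 : EuclideanSpace ℂ (Fin 2)) (α β : ℝ)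
    (i : Fin 2 × Fin 2 × Fin 2) :
    Matrix.toEuclideanLin (kron3 (branchA α β a1 a2 i) (branchSign b1 b2 i.1 i.2.1)
      (branchSign c1 c2 i.1 i.2.2)) GHZ =
      ((Real.sqrt 2 : ℂ)⁻¹ * 2⁻¹) • ((α : ℂ) • tp3 a1 b1 c1 + (β : ℂ) • tp3 a2 b2 c2) := by
  obtain ⟨k, s, t⟩ := i
  fin_cases k <;> fin_cases s <;> fin_cases t <;>
    simp [branchA, branchSign, outcomeSign, toEuclideanLin_kron3_GHZ] <;> module

/-- **Lemma 4 (deterministic conversion in the orthogonal case).**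
If `T₁ = a₁⊗b₁⊗c₁` and `T₂ = a₂⊗b₂⊗c₂` are orthogonal unit product vectors and
`α, β > 0` with `α² + β² = 1`, then `|GHZ⟩` can be transformed to `ψ = α T₁ + β T₂`
by LOCC with probability 1: there is a complete product family every branch of which
outputs a scalar multiple of `ψ`. -/
theorem ghz_to_orthogonal_state_probability_one
    (a1 b1 c1 a2 b2 c2 : EuclideanSpace ℂ (Fin 2))
    (T1 T2 ψ : EuclideanSpace ℂ (Fin 2 × Fin 2 × Fin 2))
    (hT1 : T1 = tp3 a1 b1 c1) (hT2 : T2 = tp3 a2 b2 c2)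
    (hT1n : ‖T1‖ = 1) (hT2n : ‖T2‖ = 1)
    (horth : ⟪T1, T2⟫_ℂ = 0)
    (α β : ℝ) (hα : 0 < α) (hβ : 0 < β) (hnorm : α ^ 2 + β ^ 2 = 1)
    (hψ : ψ = (α : ℂ) • T1 + (β : ℂ) • T2) :
    ∃ (m : ℕ) (A B C : Fin m → Matrix (Fin 2) (Fin 2) ℂ),
      (∑ i, (kron3 (A i) (B i) (C i))ᴴ * kron3 (A i) (B i) (C i) = 1)
      ∧ ∀ i, ∃ c : ℂ, Matrix.toEuclideanLin (kron3 (A i) (B i) (C i)) GHZ = c • ψ := by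
  rw [hT1] at hT1n hψ horth
  rw [hT2] at hT2n hψ horth
  obtain ⟨a1', b1', c1', h1, ha1, hb1, hc1⟩ := exists_unit_factors hT1n
  obtain ⟨a2', b2', c2', h2, ha2, hb2, hc2⟩ := exists_unit_factors hT2n
  rw [h1, h2] at hψ horth
  rw [inner_tp3, mul_eq_zero, mul_eq_zero, or_assoc] at horth
  let e := (Fintype.equivFin (Fin 2 × Fin 2 × Fin 2)).symm
  refine ⟨_, fun i => branchA α β a1' a2' (e i),
    fun i => branchSign b1' b2' (e i).1 (e i).2.1,
    fun i => branchSign c1' c2' (e i).1 (e i).2.2, ?_, fun i => ⟨(Real.sqrt 2 : ℂ)⁻¹ * 2⁻¹, ?_⟩⟩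
  · rw [← sum_branch_eq_one ha1 hb1 hc1 ha2 hb2 hc2 horth hnorm]
    exact e.sum_comp fun i =>
      (kron3 (branchA α β a1' a2' i) (branchSign b1' b2' i.1 i.2.1)
        (branchSign c1' c2' i.1 i.2.2))ᴴ *
      kron3 (branchA α β a1' a2' i) (branchSign b1' b2' i.1 i.2.1)
        (branchSign c1' c2' i.1 i.2.2)
  · rw [hψ]
    exact branch_apply_GHZ a1' b1' c1' a2' b2' c2' α β (e i)
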